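/- arXiv:math/0409223 — 2 statements merged into one kernel-verified Lean document; each statement's English description precedes it below -/
import Mathlib

section
/- Let (p,l) be an irregular pair with \Delta_{(p,l)} \ne 0. Then for every r \ge 1 there exists a unique m_r with l \le m_r < (p-1)p^{r-1}, m_r \equiv l (mod p-1), and p^r dividing the numerator of B_{m_r}/m_r; moreover the sequence (m_r) is nondecreasing and m_{r+1} \equiv m_r (mod (p-1)p^{r-1}). -/
theorem aux_pow_pk (p : ℕ) (hodd : Odd p) (hp2 : 2 ≤ p) (v : ℤ) (hv : (p:ℤ) ∣ v - 1) (k : ℕ) :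
    (p:ℤ)^(k+2) ∣ v^(p^k) - 1 - p^k * (v-1) := by
  induction k with
  | zero => simp
  | succ k ih =>
    set x := v^(p^k) with hx
    have hx1 : (p:ℤ)^(k+1) ∣ x - 1 := by
      have h1 : (p:ℤ)^(k+1) ∣ x - 1 - p^k*(v-1) := (pow_dvd_pow _ (by omega)).trans ih
      have h2 : (p:ℤ)^(k+1) ∣ p^k*(v-1) := by rw [pow_succ]; exact mul_dvd_mul_left _ hv
      simpa using dvd_add h1 h2
    obtain ⟨y, hy⟩ := hx1
    have hgs := odd_sq_dvd_geom_sum₂_sub (a := (1:ℤ)) (p^k*y) hodd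
    have e : (1:ℤ) + p * (p^k*y) = x := by linear_combination -hy
    rw [e] at hgs
    simp only [one_pow, mul_one] at hgs
    have hg := mul_geom_sum x p
    obtain ⟨z, hz⟩ := hgs
    obtain ⟨w, hw⟩ := ih
    have : v^(p^(k+1)) = x^p := by rw [pow_succ, pow_mul]
    rw [this]
    refine ⟨y*z + w, ?_⟩
    have hz' : ∑ i ∈ Finset.range p, x^i = p + p^2*z := by linear_combination hz
    rw [hz', hy] at hg
    linear_combination -hg + p * hw - p * hy

theorem aux_pow (p : ℕ) (hodd : Odd p) (hp2 : 2 ≤ p) (v : ℤ) (hv : (p:ℤ) ∣ v - 1) (k s t : ℕ) :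
    (p:ℤ)^(k+2) ∣ v^(s+t*p^k) - v^s - t*p^k * (v-1) := by
  obtain ⟨w, hw⟩ := aux_pow_pk p hodd hp2 v hv k
  obtain ⟨q, hq⟩ := hv
  obtain ⟨z, hz⟩ := Polynomial.powAddExpansion (1:ℤ) (v^(p^k) - 1) t
  obtain ⟨y, hy⟩ : (p:ℤ) ∣ v^s - 1 := by
    have := sub_dvd_pow_sub_pow v 1 s
    rw [one_pow] at this
    exact (Dvd.intro _ hq.symm).trans this
  have hd : v^(p^k) - 1 = p^(k+1) * (q + p*w) := by
    rw [hq] at hw; linear_combination hw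
  have e : v^(s+t*p^k) = v^s * (v^(p^k))^t := by rw [pow_add, mul_comm t, pow_mul]
  rw [e]
  have e2 : (v^(p^k))^t = 1 + t * (v^(p^k)-1) + z * (v^(p^k)-1)^2 := by
    have : (1 + (v^(p^k)-1)) = v^(p^k) := by ring
    rw [this] at hz
    rw [hz]; simp
  rw [e2, hd, hq]
  have hvs : v^s = 1 + p*y := by linear_combination hy
  rw [hvs]
  refine ⟨y*t*q + (1+p*y)*t*w + (1+p*y)*z*p^k*(q+p*w)^2, ?_⟩
  ring

theorem num_iff (p : ℕ) [Fact p.Prime] (q : ℚ) (r : ℕ) (hr : 1 ≤ r) :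
    ((p:ℤ)^r ∣ q.num) ↔ ‖(q:ℚ_[p])‖ ≤ (p:ℝ)^(-(r:ℤ)) := by
  have hq : (q:ℚ_[p]) * ((q.den:ℕ):ℚ_[p]) = ((q.num:ℤ):ℚ_[p]) := by
    have := Rat.mul_den_eq_num q
    exact_mod_cast congrArg (fun x : ℚ => (x:ℚ_[p])) this
  have hn := congrArg norm hq
  rw [norm_mul] at hn
  have key := Padic.norm_int_le_pow_iff_dvd (p := p) q.num r
  rw [← key, ← hn]
  constructor
  · intro h
    have h1 : (p:ℤ) ∣ q.num := (dvd_pow_self _ (by omega)).trans (key.1 (by rw [← hn]; exact h))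
    have h2 : ¬ p ∣ q.den := by
      intro h3
      have hc := q.reduced
      have h4 : p ∣ q.num.natAbs := Int.natCast_dvd.1 h1
      have := Nat.dvd_gcd h4 h3
      rw [hc] at this
      exact (Fact.out : p.Prime).one_lt.ne' (Nat.dvd_one.1 this)
    have h3 : ‖((q.den:ℕ):ℚ_[p])‖ = 1 := by
      rw [Padic.norm_natCast_eq_one_iff]
      exact (Nat.Prime.coprime_iff_not_dvd Fact.out).2 h2
    rwa [h3, mul_one] at h
  · intro h
    have h3 : ‖((q.den:ℕ):ℚ_[p])‖ ≤ 1 := by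
      have := Padic.norm_int_le_one (p := p) q.den
      simpa using this
    exact (mul_le_of_le_one_right (norm_nonneg _) h3).trans h

theorem tendsto_p (p : ℕ) [Fact p.Prime] :
    Filter.Tendsto (fun N : ℕ => (p:ℚ_[p])^N) Filter.atTop (nhds 0) :=
  tendsto_pow_atTop_nhds_zero_of_norm_lt_one (Padic.norm_p_lt_one)

theorem tendsto_S (p : ℕ) [Fact p.Prime] (m : ℕ) :
    Filter.Tendsto (fun N : ℕ => (∑ k ∈ Finset.range (p^N), (k:ℚ_[p])^m) / (p:ℚ_[p])^N)
      Filter.atTop (nhds ((bernoulli m : ℚ) : ℚ_[p])) := by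
  have hp0 : (p:ℚ_[p]) ≠ 0 := by exact_mod_cast (Fact.out : p.Prime).ne_zero
  have e : ∀ N : ℕ, (∑ k ∈ Finset.range (p^N), (k:ℚ_[p])^m) / (p:ℚ_[p])^N
      = ∑ i ∈ Finset.range (m+1), ((bernoulli i * (m+1).choose i / (m+1) : ℚ) : ℚ_[p]) * ((p:ℚ_[p])^N)^(m-i) := by
    intro N
    have h := congrArg (fun x : ℚ => (x:ℚ_[p])) (sum_range_pow (p^N) m)
    push_cast at h
    rw [h, Finset.sum_div]
    refine Finset.sum_congr rfl fun i hi => ?_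
    have hi' : i ≤ m := by simpa [Nat.lt_succ_iff] using hi
    have : m + 1 - i = (m - i) + 1 := by omega
    rw [this, pow_succ]
    push_cast
    field_simp
  simp_rw [e]
  have h2 : ((bernoulli m : ℚ) : ℚ_[p]) = ∑ i ∈ Finset.range (m+1), ((bernoulli i * (m+1).choose i / (m+1) : ℚ) : ℚ_[p]) * (0:ℚ_[p])^(m-i) := by
    rw [Finset.sum_range_succ, Finset.sum_eq_zero]
    · have : (m+1:ℚ) ≠ 0 := by positivity
      have h3 : bernoulli m * ((m+1).choose m : ℕ) / (m+1 : ℚ) = bernoulli m := by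
        rw [Nat.choose_succ_self_right]; push_cast; field_simp
      rw [h3]; simp
    · intro i hi
      have : i < m := by simpa using hi
      rw [zero_pow (by omega), mul_zero]
  rw [h2]
  exact tendsto_finsetSum _ fun i _ => ((tendsto_p p).pow _).const_mul _

def UU (p N : ℕ) : Finset ℕ := (Finset.range (p^N)).filter (fun a => ¬ p ∣ a)

theorem tendsto_T (p : ℕ) [Fact p.Prime] (m : ℕ) (hm : 1 ≤ m) :
    Filter.Tendsto (fun N : ℕ => (∑ k ∈ UU p (N+1), (k:ℚ_[p])^m) / (p:ℚ_[p])^(N+1))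
      Filter.atTop (nhds ((1 - (p:ℚ_[p])^(m-1)) * ((bernoulli m : ℚ) : ℚ_[p]))) := by
  have hp0 : (p:ℚ_[p]) ≠ 0 := by exact_mod_cast (Fact.out : p.Prime).ne_zero
  have e : ∀ N : ℕ, (∑ k ∈ UU p (N+1), (k:ℚ_[p])^m) / (p:ℚ_[p])^(N+1)
      = (∑ k ∈ Finset.range (p^(N+1)), (k:ℚ_[p])^m) / (p:ℚ_[p])^(N+1)
        - (p:ℚ_[p])^(m-1) * ((∑ k ∈ Finset.range (p^N), (k:ℚ_[p])^m) / (p:ℚ_[p])^N) := by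
    intro N
    have h1 := Finset.sum_filter_add_sum_filter_not (Finset.range (p^(N+1))) (fun a => p ∣ a)
      (fun k => (k:ℚ_[p])^m)
    have h2 : ∑ k ∈ (Finset.range (p^(N+1))).filter (fun a => p ∣ a), (k:ℚ_[p])^m
        = ∑ k ∈ Finset.range (p^N), ((p*k:ℕ):ℚ_[p])^m := by
      symm
      have hpp : 0 < p := (Fact.out : p.Prime).pos
      refine Finset.sum_bij (fun k _ => p * k) ?_ ?_ ?_ ?_
      · intro a ha
        simp only [Finset.mem_range, Finset.mem_filter] at ha ⊢
        refine ⟨?_, Dvd.intro _ rfl⟩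
        rw [pow_succ, mul_comm]
        exact Nat.mul_lt_mul_of_pos_right ha hpp
      · intro a _ b _ hab
        exact Nat.eq_of_mul_eq_mul_left hpp hab
      · intro b hb
        simp only [Finset.mem_range, Finset.mem_filter] at hb
        obtain ⟨h, k, rfl⟩ := hb
        refine ⟨k, ?_, rfl⟩
        rw [pow_succ, mul_comm] at h
        simpa using Nat.lt_of_mul_lt_mul_right h
      · intro a _; rfl
    rw [h2] at h1
    unfold UU
    rw [← h1]
    have h3 : ∑ k ∈ Finset.range (p^N), ((p*k:ℕ):ℚ_[p])^m
        = (p:ℚ_[p])^(m-1) * p * ∑ k ∈ Finset.range (p^N), (k:ℚ_[p])^m := by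
      rw [Finset.mul_sum]
      refine Finset.sum_congr rfl fun k _ => ?_
      rw [← pow_succ, Nat.sub_add_cancel hm]; push_cast; rw [mul_pow]
    rw [h3]
    field_simp
    ring
  simp_rw [e]
  rw [sub_mul, one_mul]
  exact ((tendsto_S p m).comp (Filter.tendsto_add_atTop_nat 1)).sub ((tendsto_S p m).const_mul _)

def GG (p c m N : ℕ) : ℤ := ∑ a ∈ UU p N, ((c*a/p^N : ℕ) : ℤ) * ((c*a : ℕ) : ℤ)^(m-1)

theorem perm_sum (p : ℕ) [Fact p.Prime] (c : ℕ) (hc : ¬ p ∣ c) (m N : ℕ) :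
    ∑ a ∈ UU p (N+1), (((c*a) % p^(N+1) : ℕ) : ℤ)^m = ∑ a ∈ UU p (N+1), (a:ℤ)^m := by
  have hp : p.Prime := Fact.out
  have hmem : ∀ a ∈ UU p (N+1), (c*a) % p^(N+1) ∈ UU p (N+1) := by
    intro a ha
    simp only [UU, Finset.mem_filter, Finset.mem_range] at ha ⊢
    refine ⟨Nat.mod_lt _ (pow_pos hp.pos _), ?_⟩
    rw [Nat.dvd_mod_iff (dvd_pow_self _ (by omega)), hp.dvd_mul]
    tauto
  have hinj : Set.InjOn (fun a => (c*a) % p^(N+1)) (UU p (N+1) : Set ℕ) := by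
    intro a ha b hb hab
    simp only [UU, Finset.coe_filter, Finset.mem_range, Set.mem_ofPred_eq] at ha hb
    have h : c * a ≡ c * b [MOD p^(N+1)] := hab
    have hg : Nat.gcd (p^(N+1)) c = 1 :=
      Nat.Coprime.pow_left _ ((Nat.Prime.coprime_iff_not_dvd hp).2 hc)
    exact Nat.ModEq.eq_of_lt_of_lt (Nat.ModEq.cancel_left_of_coprime hg h) ha.1 hb.1
  refine Finset.sum_nbij (fun a => (c*a) % p^(N+1)) hmem hinj ?_ (fun _ _ => rfl)
  exact Finset.surjOn_of_injOn_of_card_le _ hmem hinj le_rfl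

theorem GG_id (p : ℕ) [Fact p.Prime] (c : ℕ) (hc : ¬ p ∣ c) (m N : ℕ) :
    ∃ z : ℤ, ((c:ℤ)^m - 1) * ∑ a ∈ UU p (N+1), (a:ℤ)^m
      = m * (p:ℤ)^(N+1) * GG p c m (N+1) + ((p:ℤ)^(N+1))^2 * z := by
  have h1 : ∀ a : ℕ, ∃ z : ℤ, (((c*a : ℕ):ℤ))^m - (((c*a) % p^(N+1) : ℕ) : ℤ)^m
      = m * (p:ℤ)^(N+1) * (((c*a/p^(N+1) : ℕ) : ℤ) * ((c*a : ℕ) : ℤ)^(m-1)) + ((p:ℤ)^(N+1))^2 * z := by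
    intro a
    have hd : (((c*a) % p^(N+1) : ℕ) : ℤ)
        = ((c*a : ℕ):ℤ) + (-((p:ℤ)^(N+1) * ((c*a/p^(N+1) : ℕ) : ℤ))) := by
      have := Nat.div_add_mod (c*a) (p^(N+1))
      have h := congrArg (fun x : ℕ => (x:ℤ)) this
      simp only [Nat.cast_add, Nat.cast_mul, Nat.cast_pow] at h ⊢
      linear_combination h
    obtain ⟨k, hk⟩ := Polynomial.powAddExpansion ((c*a : ℕ):ℤ) (-((p:ℤ)^(N+1) * ((c*a/p^(N+1) : ℕ) : ℤ))) m
    rw [hd, hk]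
    exact ⟨-k * ((c*a/p^(N+1) : ℕ) : ℤ)^2, by ring⟩
  choose z hz using h1
  refine ⟨∑ a ∈ UU p (N+1), z a, ?_⟩
  have h2 := Finset.sum_congr (rfl : UU p (N+1) = UU p (N+1)) (fun a _ => hz a)
  rw [Finset.sum_sub_distrib, perm_sum p c hc, Finset.sum_add_distrib, ← Finset.mul_sum,
    ← Finset.mul_sum] at h2
  rw [GG, ← h2, sub_mul, one_mul, Finset.mul_sum]
  simp [mul_pow]

theorem tendsto_GG (p : ℕ) [Fact p.Prime] (c : ℕ) (hc : ¬ p ∣ c) (m : ℕ) (hm : 1 ≤ m) :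
    Filter.Tendsto (fun N : ℕ => ((GG p c m (N+1) : ℤ) : ℚ_[p])) Filter.atTop
      (nhds (((c:ℚ_[p])^m - 1) * (1 - (p:ℚ_[p])^(m-1)) * ((bernoulli m / m : ℚ) : ℚ_[p]))) := by
  have hp0 : (p:ℚ_[p]) ≠ 0 := by exact_mod_cast (Fact.out : p.Prime).ne_zero
  have hm0 : (m:ℚ_[p]) ≠ 0 := by
    have : m ≠ 0 := by omega
    exact_mod_cast this
  choose z hz using GG_id p c hc m
  have e : ∀ N, ((GG p c m (N+1) : ℤ) : ℚ_[p])
     = (((c:ℚ_[p])^m - 1) * ((∑ k ∈ UU p (N+1), (k:ℚ_[p])^m) / (p:ℚ_[p])^(N+1))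
       - (p:ℚ_[p])^(N+1) * (z N : ℚ_[p])) / m := by
    intro N
    have h := congrArg (fun x : ℤ => (x:ℚ_[p])) (hz N)
    push_cast at h
    field_simp
    linear_combination -h
  simp_rw [e]
  have hz0 : Filter.Tendsto (fun N => (p:ℚ_[p])^(N+1) * (z N : ℚ_[p])) Filter.atTop (nhds 0) := by
    have := ((tendsto_p p).comp (Filter.tendsto_add_atTop_nat 1)).norm
    rw [norm_zero] at this
    refine squeeze_zero_norm (fun N => ?_) this
    rw [norm_mul]
    exact mul_le_of_le_one_right (norm_nonneg _) (Padic.norm_int_le_one _)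
  have := (((tendsto_T p m hm).const_mul ((c:ℚ_[p])^m - 1)).sub hz0).div_const (m:ℚ_[p])
  convert this using 2
  push_cast
  ring

theorem GG_cong (p : ℕ) [Fact p.Prime] (hodd : Odd p) (c : ℕ) (hc : ¬ p ∣ c) (l : ℕ) (hl : 1 ≤ l)
    (s t k N : ℕ) :
    (p:ℤ)^(k+2) ∣ GG p c (l + (s+t*p^k)*(p-1)) N - GG p c (l+s*(p-1)) N
      - t * p^k * (GG p c (l+1*(p-1)) N - GG p c (l+0*(p-1)) N) := by
  have hp : p.Prime := Fact.out
  unfold GG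
  rw [← Finset.sum_sub_distrib, ← Finset.sum_sub_distrib, Finset.mul_sum, ← Finset.sum_sub_distrib]
  refine Finset.dvd_sum fun a ha => ?_
  simp only [UU, Finset.mem_filter, Finset.mem_range] at ha
  have hu : (p:ℤ) ∣ ((c*a:ℕ):ℤ)^(p-1) - 1 := by
    have h1 : ¬ p ∣ c * a := by rw [hp.dvd_mul]; tauto
    have h2 : IsCoprime ((c*a:ℕ):ℤ) p := by
      rw [Nat.isCoprime_iff_coprime]
      exact ((Nat.Prime.coprime_iff_not_dvd hp).2 h1).symm
    exact (Int.ModEq.pow_card_sub_one_eq_one hp h2).symm.dvd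
  have e : ∀ s, ((c*a:ℕ):ℤ)^(l + s*(p-1) - 1) = ((c*a:ℕ):ℤ)^(l-1) * (((c*a:ℕ):ℤ)^(p-1))^s := by
    intro s
    rw [← pow_mul, ← pow_add]
    congr 1
    rw [mul_comm s]; omega
  rw [e, e, e, e]
  obtain ⟨w, hw⟩ := aux_pow p hodd hp.two_le _ hu k s t
  refine ⟨((c*a/p^N : ℕ) : ℤ) * ((c*a:ℕ):ℤ)^(l-1) * w, ?_⟩
  linear_combination ((c*a/p^N : ℕ) : ℤ) * ((c*a:ℕ):ℤ)^(l-1) * hw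

theorem GG_cong1 (p : ℕ) [Fact p.Prime] (c : ℕ) (hc : ¬ p ∣ c) (l : ℕ) (hl : 1 ≤ l) (N : ℕ) :
    (p:ℤ)^1 ∣ GG p c (l+1*(p-1)) N - GG p c (l+0*(p-1)) N := by
  have hp : p.Prime := Fact.out
  unfold GG
  rw [← Finset.sum_sub_distrib]
  refine Finset.dvd_sum fun a ha => ?_
  simp only [UU, Finset.mem_filter, Finset.mem_range] at ha
  have hu : (p:ℤ) ∣ ((c*a:ℕ):ℤ)^(p-1) - 1 := by
    have h1 : ¬ p ∣ c * a := by rw [hp.dvd_mul]; tauto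
    have h2 : IsCoprime ((c*a:ℕ):ℤ) p := by
      rw [Nat.isCoprime_iff_coprime]
      exact ((Nat.Prime.coprime_iff_not_dvd hp).2 h1).symm
    exact (Int.ModEq.pow_card_sub_one_eq_one hp h2).symm.dvd
  have e : ∀ s, ((c*a:ℕ):ℤ)^(l + s*(p-1) - 1) = ((c*a:ℕ):ℤ)^(l-1) * (((c*a:ℕ):ℤ)^(p-1))^s := by
    intro s
    rw [← pow_mul, ← pow_add]
    congr 1
    rw [mul_comm s]; omega
  rw [e, e]
  obtain ⟨w, hw⟩ := hu
  refine ⟨((c*a/p^N : ℕ) : ℤ) * ((c*a:ℕ):ℤ)^(l-1) * w, ?_⟩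
  linear_combination ((c*a/p^N : ℕ) : ℤ) * ((c*a:ℕ):ℤ)^(l-1) * hw

/-- A limit of integers divisible by `p^k` has small norm. -/
theorem lim_norm (p : ℕ) [Fact p.Prime] (f : ℕ → ℤ) (L : ℚ_[p]) (k : ℕ)
    (h : Filter.Tendsto (fun N => (f N : ℚ_[p])) Filter.atTop (nhds L))
    (hd : ∀ N, (p:ℤ)^k ∣ f N) : ‖L‖ ≤ (p:ℝ)^(-(k:ℤ)) :=
  le_of_tendsto' h.norm fun N => (Padic.norm_int_le_pow_iff_dvd _ _).2 (hd N)

theorem hensel (p : ℕ) [Fact p.Prime] (g : ℕ → ℤ_[p]) (h0 : (p:ℤ_[p]) ∣ g 0)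
    (h1 : (p:ℤ_[p]) ∣ g 1 - g 0) (h2 : ¬ (p:ℤ_[p])^2 ∣ g 1 - g 0)
    (hc : ∀ s t k : ℕ, (p:ℤ_[p])^(k+2) ∣ g (s+t*p^k) - g s - t*p^k*(g 1 - g 0)) (k : ℕ) :
    ∃ s < p^k, (p:ℤ_[p])^(k+1) ∣ g s ∧ ∀ s' < p^k, (p:ℤ_[p])^(k+1) ∣ g s' → s' = s := by
  have hp : p.Prime := Fact.out
  have hp0 : (p:ℤ_[p]) ≠ 0 := by exact_mod_cast hp.ne_zero
  have hker : ∀ x : ℤ_[p], PadicInt.toZMod x = 0 ↔ (p:ℤ_[p]) ∣ x := by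
    intro x
    rw [← RingHom.mem_ker, PadicInt.ker_toZMod, PadicInt.maximalIdeal_eq_span_p,
      Ideal.mem_span_singleton]
  obtain ⟨δ, hδ⟩ := h1
  have hδ0 : (PadicInt.toZMod δ : ZMod p) ≠ 0 := by
    rw [Ne, hker]
    rintro ⟨y, rfl⟩
    exact h2 ⟨y, by rw [hδ]; ring⟩
  induction k with
  | zero =>
    refine ⟨0, by simp, by simpa using h0, ?_⟩
    intro s' hs' _
    simpa using hs'
  | succ k ih =>
    obtain ⟨s, hs, ⟨y, hy⟩, hu⟩ := ih
    have key : ∀ t : ℕ, (p:ℤ_[p])^(k+1+1) ∣ g (s+t*p^k) ↔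
        PadicInt.toZMod y + (t:ZMod p) * PadicInt.toZMod δ = 0 := by
      intro t
      have e : PadicInt.toZMod y + (t:ZMod p) * PadicInt.toZMod δ
        = PadicInt.toZMod (y + (t:ℤ_[p]) * δ) := by simp
      rw [e, hker, ← mul_dvd_mul_iff_left (a := (p:ℤ_[p])^(k+1)) (b := (p:ℤ_[p]))
        (pow_ne_zero (k+1) hp0), ← pow_succ]
      refine dvd_iff_dvd_of_dvd_sub ?_
      convert hc s t k using 1
      rw [hy, hδ]; ring
    have hex : ∃ t < p, PadicInt.toZMod y + (t:ZMod p) * PadicInt.toZMod δ = 0 := by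
      refine ⟨(-PadicInt.toZMod y / PadicInt.toZMod δ : ZMod p).val, ZMod.val_lt _, ?_⟩
      rw [ZMod.natCast_zmod_val]
      field_simp
      ring
    obtain ⟨t, ht, hty⟩ := hex
    refine ⟨s + t*p^k, ?_, (key t).2 hty, ?_⟩
    · calc s + t*p^k < p^k + t * p^k := by omega
        _ = (t+1)*p^k := by ring
        _ ≤ p * p^k := Nat.mul_le_mul_right _ ht
        _ = p^(k+1) := by ring
    · intro s' hs' hd
      have hdm := Nat.mod_add_div s' (p^k)
      have hpk : 0 < p^k := pow_pos hp.pos _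
      set s0 := s' % p^k with hs0
      set t' := s' / p^k with ht'
      have hss : s' = s0 + t' * p^k := by rw [mul_comm]; exact hdm.symm
      have ht'p : t' < p := by
        rw [ht', Nat.div_lt_iff_lt_mul hpk, ← pow_succ']; exact hs'
      have hd0 : (p:ℤ_[p])^(k+1) ∣ g s0 := by
        have a1 := (pow_dvd_pow (p:ℤ_[p]) (show k+1 ≤ k+2 by omega)).trans (hc s0 t' k)
        rw [← hss] at a1
        have a2 : (p:ℤ_[p])^(k+1) ∣ g s' := (pow_dvd_pow _ (by omega)).trans hd
        have a3 : (p:ℤ_[p])^(k+1) ∣ t'*p^k*(g 1 - g 0) := ⟨t' * δ, by rw [hδ]; ring⟩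
        have := dvd_sub (dvd_sub a2 a1) a3
        convert this using 1; ring
      have hs0s : s0 = s := hu s0 (Nat.mod_lt _ hpk) hd0
      rw [hs0s] at hss
      rw [hss] at hd
      have h3 := (key t').1 hd
      have h4 : (t':ZMod p) = (t:ZMod p) := by
        have : ((t':ZMod p) - t) * PadicInt.toZMod δ = 0 := by linear_combination h3 - hty
        exact sub_eq_zero.1 ((mul_eq_zero.1 this).resolve_right hδ0)
      have h5 : t' = t := by
        rw [ZMod.natCast_eq_natCast_iff] at h4
        exact Nat.ModEq.eq_of_lt_of_lt h4 ht'p ht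
      rw [hss, h5]

theorem exists_c (p l : ℕ) [Fact p.Prime] (hl2 : 1 ≤ l) (hlp : l < p - 1) :
    ∃ c : ℕ, ¬ p ∣ c ∧ ∀ s : ℕ, ¬ (p:ℤ) ∣ (c:ℤ)^(l+s*(p-1)) - 1 := by
  obtain ⟨u, hu⟩ := IsCyclic.exists_generator (α := (ZMod p)ˣ)
  have ho : orderOf u = p - 1 := by
    rw [orderOf_eq_card_of_forall_mem_zpowers hu, Nat.card_eq_fintype_card, ZMod.card_units]
  refine ⟨(u : ZMod p).val, ?_, ?_⟩
  · rw [← ZMod.natCast_eq_zero_iff, ZMod.natCast_zmod_val]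
    exact u.ne_zero
  · intro s h
    rw [← ZMod.intCast_zmod_eq_zero_iff_dvd] at h
    push_cast at h
    rw [ZMod.natCast_zmod_val, sub_eq_zero] at h
    have h2 : u^(l+s*(p-1)) = 1 := by ext; push_cast; exact h
    have h3 := orderOf_dvd_of_pow_eq_one h2
    rw [ho] at h3
    have h4 := (Nat.dvd_add_left (Dvd.intro_left s rfl)).1 h3
    exact absurd (Nat.le_of_dvd (by omega) h4) (by omega)

theorem norm_one_of (p : ℕ) [Fact p.Prime] (z : ℤ) (h : ¬ (p:ℤ) ∣ z) : ‖(z:ℚ_[p])‖ = 1 := by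
  rw [Padic.norm_intCast_eq_one_iff, isCoprime_comm]
  exact (Prime.coprime_iff_not_dvd (Nat.prime_iff_prime_int.1 Fact.out)).2 h

theorem exists_g (p l : ℕ) [Fact p.Prime] (hodd : Odd p)
    (hl2 : 2 ≤ l) (hlp : l < p - 1)
    (hirr : (p : ℤ) ∣ (bernoulli l).num)
    (hΔ : ¬ ((p : ℤ)^2) ∣
      (bernoulli (l + p - 1) / (l + p - 1) - bernoulli l / l).num) :
    ∃ g : ℕ → ℤ_[p], (p:ℤ_[p]) ∣ g 0 ∧ (p:ℤ_[p]) ∣ g 1 - g 0 ∧ ¬ (p:ℤ_[p])^2 ∣ g 1 - g 0 ∧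
    (∀ s t k : ℕ, (p:ℤ_[p])^(k+2) ∣ g (s+t*p^k) - g s - t*p^k*(g 1 - g 0)) ∧
    ∀ s r : ℕ, 1 ≤ r → ((p:ℤ_[p])^r ∣ g s ↔
      (p:ℤ)^r ∣ (bernoulli (l+s*(p-1)) / ((l+s*(p-1) : ℕ):ℚ)).num) := by
  have hp : p.Prime := Fact.out
  obtain ⟨c, hc, hcs⟩ := exists_c p l (by omega) hlp
  set E : ℕ → ℤ := fun s => ((c:ℤ)^(l+s*(p-1)) - 1) * (1 - (p:ℤ)^(l+s*(p-1)-1)) with hE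
  set b : ℕ → ℚ := fun s => bernoulli (l+s*(p-1)) / ((l+s*(p-1) : ℕ):ℚ) with hb
  set L : ℕ → ℚ_[p] := fun s => (E s : ℚ_[p]) * ((b s : ℚ) : ℚ_[p]) with hL
  have hT : ∀ s, Filter.Tendsto (fun N : ℕ => ((GG p c (l+s*(p-1)) (N+1) : ℤ) : ℚ_[p]))
      Filter.atTop (nhds (L s)) := by
    intro s
    have := tendsto_GG p c hc (l+s*(p-1)) (by omega)
    simp only [hL, hE, hb]
    convert this using 2
    push_cast
    ring
  have hpE : ∀ s, (p:ℤ) ∣ (p:ℤ)^(l+s*(p-1)-1) := fun s => dvd_pow_self _ (by omega)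
  have hEn : ∀ s, ‖(E s : ℚ_[p])‖ = 1 := by
    intro s
    apply norm_one_of
    intro h
    rcases (Nat.prime_iff_prime_int.1 hp).dvd_or_dvd h with h | h
    · exact hcs s h
    · have := dvd_add h (hpE s)
      rw [sub_add_cancel] at this
      exact (Nat.prime_iff_prime_int.1 hp).not_dvd_one this
  have hLn : ∀ s, ‖L s‖ = ‖((b s : ℚ) : ℚ_[p])‖ := by
    intro s
    rw [hL]; simp only [norm_mul, hEn, one_mul]
  have hL1 : ∀ s, ‖L s‖ ≤ 1 := by
    intro s
    have := lim_norm p _ _ 0 (hT s) (by simp)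
    simpa using this
  have hdv : ∀ (x : ℤ_[p]) (k : ℕ), (p:ℤ_[p])^k ∣ x ↔ ‖(x:ℚ_[p])‖ ≤ (p:ℝ)^(-(k:ℤ)) := by
    intro x k
    rw [← PadicInt.norm_def, PadicInt.norm_le_pow_iff_mem_span_pow, Ideal.mem_span_singleton]
  have hb0 : ‖((b 0 : ℚ) : ℚ_[p])‖ ≤ (p:ℝ)^(-((1:ℕ):ℤ)) := by
    have h1 := (num_iff p (bernoulli l) 1 le_rfl).1 (by simpa using hirr)
    have h2 : ‖((l:ℕ):ℚ_[p])‖ = 1 := by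
      have := norm_one_of p l (fun h => by
        have := Nat.le_of_dvd (by omega) (Int.natCast_dvd_natCast.1 h)
        omega)
      simpa using this
    have h3 : b 0 = bernoulli l / (l:ℚ) := by simp [hb]
    rw [h3]
    push_cast
    rw [norm_div, h2, div_one]
    exact h1
  obtain ⟨g, hgL⟩ : ∃ g : ℕ → ℤ_[p], ∀ s, ((g s : ℤ_[p]) : ℚ_[p]) = L s :=
    ⟨fun s => ⟨L s, hL1 s⟩, fun _ => rfl⟩
  refine ⟨g, ?_, ?_, ?_, ?_, ?_⟩
  · rw [← pow_one (p:ℤ_[p]), hdv]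
    rw [hgL, hLn]; exact hb0
  · rw [← pow_one (p:ℤ_[p]), hdv]
    rw [PadicInt.coe_sub, hgL, hgL]
    refine lim_norm p (fun N => GG p c (l+1*(p-1)) (N+1) - GG p c (l+0*(p-1)) (N+1)) _ 1 ?_ ?_
    · push_cast
      exact (hT 1).sub (hT 0)
    · intro N
      exact GG_cong1 p c hc l (by omega) _
  · rw [hdv]
    rw [PadicInt.coe_sub, hgL, hgL]
    intro h
    apply hΔ
    have e1 : bernoulli (l + p - 1) / ((l:ℚ) + p - 1) = b 1 := by
      have a1 : l + p - 1 = l + 1*(p-1) := by omega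
      have a2 : (l:ℚ) + p - 1 = ((l+1*(p-1) : ℕ) : ℚ) := by
        rw [← a1, Nat.cast_sub (by omega)]; push_cast; ring
      rw [a1, a2]
    have e0 : bernoulli l / (l:ℚ) = b 0 := by simp [hb]
    rw [e1, e0, num_iff p _ 2 (by omega)]
    have e2 : (E 1 : ℚ_[p]) * ((b 1 - b 0 : ℚ) : ℚ_[p])
        = (L 1 - L 0) + ((E 0 - E 1 : ℤ) : ℚ_[p]) * ((b 0 : ℚ) : ℚ_[p]) := by
      simp only [hL]; push_cast; ring
    have e3 := congrArg norm e2
    rw [norm_mul, hEn, one_mul] at e3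
    rw [e3]
    refine (Padic.nonarchimedean _ _).trans (max_le h ?_)
    have h4 : (p:ℤ)^1 ∣ E 0 - E 1 := by
      have hf : (p:ℤ) ∣ (c:ℤ)^(p-1) - 1 := by
        have h2 : IsCoprime ((c:ℕ):ℤ) p := by
          rw [Nat.isCoprime_iff_coprime]
          exact ((Nat.Prime.coprime_iff_not_dvd hp).2 hc).symm
        exact (Int.ModEq.pow_card_sub_one_eq_one hp h2).symm.dvd
      obtain ⟨x, hx⟩ := hf
      obtain ⟨y, hy⟩ := hpE 0
      obtain ⟨z, hz⟩ := hpE 1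
      have hc1 : (c:ℤ)^(l+1*(p-1)) = c^l * (p*x+1) := by
        rw [one_mul, pow_add, ← hx]; ring
      have hc0 : (c:ℤ)^(l+0*(p-1)) = c^l := by simp
      simp only [hE]
      rw [hy, hz, hc1, hc0]
      exact ⟨-(c^l-1)*y - c^l*x + (c^l*(p*x+1)-1)*z, by ring⟩
    have h5 := (Padic.norm_int_le_pow_iff_dvd (p := p) _ 1).2 h4
    rw [norm_mul]
    refine (mul_le_mul h5 hb0 (norm_nonneg _) (by positivity)).trans (le_of_eq ?_)
    rw [← zpow_add₀ (by exact_mod_cast hp.ne_zero)]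
    norm_num
  · intro s t k
    rw [hdv]
    push_cast
    simp only [hgL]
    have := lim_norm p (fun N => GG p c (l + (s+t*p^k)*(p-1)) (N+1) - GG p c (l+s*(p-1)) (N+1)
      - t * p^k * (GG p c (l+1*(p-1)) (N+1) - GG p c (l+0*(p-1)) (N+1)))
      (L (s+t*p^k) - L s - t*p^k*(L 1 - L 0)) (k+2) ?_ ?_
    · simpa using this
    · push_cast
      exact ((hT _).sub (hT s)).sub (((hT 1).sub (hT 0)).const_mul _)
    · intro N
      exact GG_cong p hodd c hc l (by omega) s t k _
  · intro s r hr
    rw [hdv, num_iff p _ r hr, hgL, hLn]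

/-- Let `(p, l)` be an irregular pair with
`B_l/l ≢ B_{l+p-1}/(l+p-1) (mod p²)`.  Then for every `r ≥ 1` there is a unique
`m_r` with `l ≤ m_r < (p-1)p^{r-1}`, `m_r ≡ l (mod p-1)` and
`p^r ∣ numer(B_{m_r}/m_r)`; the sequence `(m_r)` is nondecreasing and satisfies
`m_{r+1} ≡ m_r (mod (p-1)p^{r-1})`. -/
theorem stmt_17 (p l : ℕ) (hp : p.Prime) (hodd : Odd p)
    (hl2 : 2 ≤ l) (hlp : l ≤ p - 3) (hle : Even l)
    (hirr : (p : ℤ) ∣ (bernoulli l).num)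
    (hΔ : ¬ ((p : ℤ)^2) ∣
      (bernoulli (l + p - 1) / (l + p - 1) - bernoulli l / l).num) :
    ∃ m : ℕ → ℕ, ∀ r : ℕ, 1 ≤ r →
      (l ≤ m r ∧ m r < (p - 1) * p^(r - 1) ∧ m r ≡ l [MOD p - 1] ∧
        ((p : ℤ)^r) ∣ (bernoulli (m r) / (m r)).num) ∧
      (∀ m' : ℕ, l ≤ m' → m' < (p - 1) * p^(r - 1) → m' ≡ l [MOD p - 1] →
        ((p : ℤ)^r) ∣ (bernoulli m' / m').num → m' = m r) ∧
      m r ≤ m (r + 1) ∧ m (r + 1) ≡ m r [MOD (p - 1) * p^(r - 1)] := by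
  haveI : Fact p.Prime := ⟨hp⟩
  have hlt : l < p - 1 := by omega
  obtain ⟨g, h0, h1, h2, hc, hg⟩ := exists_g p l hodd hl2 hlt hirr hΔ
  choose S hS hSd hSu using hensel p g h0 h1 h2 hc
  refine ⟨fun r => l + S (r-1) * (p-1), fun r hr => ?_⟩
  obtain ⟨k, rfl⟩ : ∃ k, r = k + 1 := ⟨r - 1, by omega⟩
  simp only [Nat.add_sub_cancel]
  have hpk : 0 < p^k := pow_pos hp.pos _
  obtain ⟨δ, hδ⟩ := h1
  have hmod : S (k+1) % p^k = S k := by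
    refine hSu k _ (Nat.mod_lt _ hpk) ?_
    have hdm := Nat.mod_add_div (S (k+1)) (p^k)
    set s0 := S (k+1) % p^k
    set t := S (k+1) / p^k
    have hss : S (k+1) = s0 + t * p^k := by rw [mul_comm]; exact hdm.symm
    have a1 := (pow_dvd_pow (p:ℤ_[p]) (show k+1 ≤ k+2 by omega)).trans (hc s0 t k)
    rw [← hss] at a1
    have a2 : (p:ℤ_[p])^(k+1) ∣ g (S (k+1)) := (pow_dvd_pow _ (by omega)).trans (hSd (k+1))
    have a3 : (p:ℤ_[p])^(k+1) ∣ t*p^k*(g 1 - g 0) := ⟨t * δ, by rw [hδ]; ring⟩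
    have := dvd_sub (dvd_sub a2 a1) a3
    convert this using 1; ring
  refine ⟨⟨by omega, ?_, ?_, ?_⟩, ?_, ?_, ?_⟩
  · calc l + S k * (p-1) < (p-1) + S k * (p-1) := by omega
      _ = (p-1) * (S k + 1) := by ring
      _ ≤ (p-1) * p^k := Nat.mul_le_mul_left _ (hS k)
  · simp [Nat.ModEq]
  · exact (hg (S k) (k+1) hr).1 (hSd k)
  · intro m' hm1 hm2 hm3 hm4
    obtain ⟨s, hs⟩ := (Nat.modEq_iff_dvd' hm1).1 hm3.symm
    have hms : m' = l + s * (p-1) := by rw [mul_comm s]; omega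
    have hsk : s < p^k := by
      have : (p-1) * s < (p-1) * p^k := by omega
      exact Nat.lt_of_mul_lt_mul_left this
    rw [hms] at hm4 ⊢
    rw [hSu k s hsk ((hg s (k+1) hr).2 hm4)]
  · have : S k ≤ S (k+1) := hmod ▸ Nat.mod_le _ _
    have := Nat.mul_le_mul_right (p-1) this
    omega
  · refine Nat.ModEq.add_left l ?_
    have : S (k+1) ≡ S k [MOD p^k] := by
      rw [Nat.ModEq, hmod, Nat.mod_eq_of_lt (hS k)]
    have := Nat.ModEq.mul_right' (p-1) this
    rwa [mul_comm (p^k)] at this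
end

section
/- Let n be an even positive integer and p a prime with p^r || n (r = ord_p n \ge 1) and p-1 \nmid n. If p does not divide the numerator of B_l/l for the unique l with l \equiv n (mod p-1), 0 < l < p-1 (in particular if p is a regular prime), then p^r exactly divides the numerator of B_n, i.e., ord_p B_n = r. -/
/-- `x` is `p`-integral. -/
def PInt (p : ℕ) (x : ℚ) : Prop := ∃ (u : ℤ) (d : ℕ), ¬ p ∣ d ∧ x * d = u

lemma PInt.int {p : ℕ} (hp : p.Prime) (z : ℤ) : PInt p z :=
  ⟨z, 1, by simpa using hp.one_lt.ne', by simp⟩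

lemma PInt.nat {p : ℕ} (hp : p.Prime) (z : ℕ) : PInt p z := by
  simpa using PInt.int hp (z : ℤ)

lemma PInt.add {p : ℕ} (hp : p.Prime) {x y : ℚ} (hx : PInt p x) (hy : PInt p y) :
    PInt p (x + y) := by
  obtain ⟨u, d, hd, h⟩ := hx
  obtain ⟨v, e, he, h'⟩ := hy
  refine ⟨u * e + v * d, d * e, fun h => (hp.dvd_mul.1 h).elim hd he, ?_⟩
  push_cast
  rw [← h, ← h']
  ring

lemma PInt.mul {p : ℕ} (hp : p.Prime) {x y : ℚ} (hx : PInt p x) (hy : PInt p y) :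
    PInt p (x * y) := by
  obtain ⟨u, d, hd, h⟩ := hx
  obtain ⟨v, e, he, h'⟩ := hy
  refine ⟨u * v, d * e, fun h => (hp.dvd_mul.1 h).elim hd he, ?_⟩
  push_cast
  rw [← h, ← h']
  ring

lemma PInt.neg {p : ℕ} {x : ℚ} (hx : PInt p x) : PInt p (-x) := by
  obtain ⟨u, d, hd, h⟩ := hx
  exact ⟨-u, d, hd, by push_cast; rw [← h]; ring⟩

lemma PInt.sum {p : ℕ} (hp : p.Prime) {ι : Type*} (s : Finset ι) (f : ι → ℚ)
    (h : ∀ i ∈ s, PInt p (f i)) : PInt p (∑ i ∈ s, f i) := by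
  classical
  induction s using Finset.induction_on with
  | empty => simpa using PInt.int hp 0
  | insert a s ha ih =>
    rw [Finset.sum_insert ha]
    exact PInt.add hp (h _ (by simp)) (ih fun i hi => h i (by simp [hi]))

lemma PInt.inv {p : ℕ} {d : ℕ} (hd : ¬ p ∣ d) : PInt p ((d : ℚ)⁻¹) := by
  refine ⟨1, d, hd, ?_⟩
  have : (d : ℚ) ≠ 0 := by
    rintro h
    exact hd (by simp [Nat.cast_eq_zero.1 h])
  simp [this]

lemma PInt.mul_bernoulli {p : ℕ} (hp : p.Prime) (h5 : 5 ≤ p) (i : ℕ) :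
    PInt p (p * bernoulli i) := by
  rcases Nat.even_or_odd' i with ⟨k, rfl | rfl⟩
  · obtain ⟨z, hz⟩ := Bernoulli.vonStaudt_clausen k
    have : (p : ℚ) * bernoulli (2 * k) = p * z + -(∑ q ∈ Finset.range (2 * k + 2) with
        q.Prime ∧ (q - 1) ∣ 2 * k, (p : ℚ) * (1 / q)) := by
      rw [hz, ← Finset.mul_sum]; ring
    rw [this]
    refine PInt.add hp (PInt.mul hp (PInt.nat hp _) (PInt.int hp _)) (PInt.neg ?_)
    refine PInt.sum hp _ _ fun q hq => ?_
    simp only [Finset.mem_filter] at hq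
    by_cases hqp : q = p
    · subst hqp
      have : (q : ℚ) ≠ 0 := by exact_mod_cast hp.ne_zero
      rw [mul_one_div_cancel this]
      simpa using PInt.nat hp 1
    · rw [one_div]
      refine PInt.mul hp (PInt.nat hp _) (PInt.inv ?_)
      intro h
      exact hqp ((Nat.prime_dvd_prime_iff_eq hp hq.2.1).1 h).symm
  · rcases Nat.eq_zero_or_pos k with rfl | hk
    · refine PInt.mul hp (PInt.nat hp _) ?_
      refine ⟨-1, 2, fun h => ?_, by norm_num⟩
      have := Nat.le_of_dvd (by norm_num) h
      omega
    · rw [bernoulli_eq_zero_of_odd ⟨k, rfl⟩ (by omega), mul_zero]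
      simpa using PInt.nat hp 0

lemma PInt.bernoulli_odd {p : ℕ} (hp : p.Prime) (h5 : 5 ≤ p) (i : ℕ) (hi : Odd i) :
    PInt p (bernoulli i) := by
  by_cases h1 : i = 1
  · subst h1
    refine ⟨-1, 2, fun h => ?_, by norm_num⟩
    have := Nat.le_of_dvd (by norm_num) h
    omega
  · rw [bernoulli_eq_zero_of_odd hi (by obtain ⟨k, rfl⟩ := hi; omega)]
    simpa using PInt.nat hp 0

lemma PInt.pow_div {p : ℕ} (hp : p.Prime) (h5 : 5 ≤ p) (m K : ℕ) (hm : 2 ≤ m) (hK : m - 2 ≤ K) :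
    PInt p ((p : ℚ) ^ K * ((m + 1 : ℕ) : ℚ)⁻¹) := by
  obtain ⟨e, d, hd, hed⟩ := Nat.exists_eq_pow_mul_and_not_dvd (n := m + 1) (by omega) p hp.ne_one
  have he : e ≤ m - 2 := by
    by_contra hc
    have h1 : p ^ e ≤ m + 1 := Nat.le_of_dvd (by omega) ⟨d, hed⟩
    have h2 : 5 ^ (m - 1) ≤ p ^ e :=
      (Nat.pow_le_pow_left h5 _).trans (Nat.pow_le_pow_right hp.pos (by omega))
    obtain ⟨t, rfl⟩ : ∃ t, m = t + 2 := ⟨m - 2, by omega⟩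
    have h3 : ∀ t : ℕ, t + 3 < 5 ^ (t + 1) := by
      intro t
      induction t with
      | zero => norm_num
      | succ t ih => rw [pow_succ]; omega
    have := h3 t
    have h4 : t + 2 - 1 = t + 1 := by omega
    rw [h4] at h2
    omega
  have hp0 : (p : ℚ) ≠ 0 := by exact_mod_cast hp.ne_zero
  have : (p : ℚ) ^ K * ((m + 1 : ℕ) : ℚ)⁻¹ = ((p ^ (K - e) : ℕ) : ℚ) * (d : ℚ)⁻¹ := by
    rw [hed]
    push_cast
    rw [show (p : ℚ) ^ K = p ^ (K - e) * p ^ e by rw [← pow_add]; congr 1; omega]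
    rw [mul_inv]
    field_simp
  rw [this]
  exact PInt.mul hp (PInt.nat hp _) (PInt.inv hd)

lemma faulhaber_mod {p : ℕ} (hp : p.Prime) (h5 : 5 ≤ p) (k n : ℕ) (hk : 1 ≤ k) (hn : Even n) :
    ∃ x, PInt p x ∧ ∑ j ∈ Finset.range (p ^ k), (j : ℚ) ^ n =
      (p ^ k : ℕ) * bernoulli n + ((p ^ k : ℕ) : ℚ) ^ 2 * x := by
  refine ⟨∑ i ∈ Finset.range n, bernoulli i * (n.choose i) *
    (((p ^ k : ℕ) : ℚ) ^ (n - i - 1) * ((n - i + 1 : ℕ) : ℚ)⁻¹), ?_, ?_⟩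
  · refine PInt.sum hp _ _ fun i hi => ?_
    have hi := Finset.mem_range.1 hi
    by_cases h1 : n - i = 1
    · rw [h1]
      refine PInt.mul hp (PInt.mul hp (PInt.bernoulli_odd hp h5 i ?_) (PInt.nat hp _)) ?_
      · obtain ⟨t, rfl⟩ := hn
        exact ⟨t - 1, by omega⟩
      · simp only [Nat.sub_self, pow_zero, one_mul]
        refine PInt.inv fun h => ?_
        have := Nat.le_of_dvd (by norm_num) h
        omega
    · obtain ⟨m, hm⟩ : ∃ m, n - i = m := ⟨_, rfl⟩
      rw [hm] at h1 ⊢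
      have hkm : m - 1 ≤ k * (m - 1) := Nat.le_mul_of_pos_left _ hk
      have : bernoulli i * (n.choose i) * (((p ^ k : ℕ) : ℚ) ^ (m - 1) * ((m + 1 : ℕ) : ℚ)⁻¹)
        = (p * bernoulli i) * (n.choose i) * ((p : ℚ) ^ (k * (m - 1) - 1) * ((m + 1 : ℕ) : ℚ)⁻¹) := by
        push_cast
        rw [← pow_mul, show k * (m - 1) = (k * (m - 1) - 1) + 1 by omega, pow_succ]
        simp only [Nat.add_sub_cancel]
        ring
      rw [this]
      exact PInt.mul hp (PInt.mul hp (PInt.mul_bernoulli hp h5 i) (PInt.nat hp _))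
        (PInt.pow_div hp h5 m _ (by omega) (by omega))
  · rw [sum_range_pow, Finset.sum_range_succ, add_comm, Finset.mul_sum]
    have hn1 : ((n : ℚ) + 1) ≠ 0 := by positivity
    congr 1
    · rw [Nat.choose_succ_self_right, Nat.add_sub_cancel_left]
      push_cast
      field_simp
    · refine Finset.sum_congr rfl fun i hi => ?_
      have hi := Finset.mem_range.1 hi
      have hc := Nat.choose_mul_succ_eq n i
      have hc' : (n.choose i : ℚ) * (n + 1) = ((n + 1).choose i) * ((n - i + 1 : ℕ) : ℚ) := by
        rw [show n - i + 1 = n + 1 - i by omega]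
        exact_mod_cast hc
      have h0 : ((n - i + 1 : ℕ) : ℚ) ≠ 0 := by positivity
      rw [show n + 1 - i = 2 + (n - i - 1) by omega, pow_add]
      generalize ((n - i + 1 : ℕ) : ℚ) = w at *
      generalize ((p ^ k : ℕ) : ℚ) ^ (n - i - 1) = v at *
      generalize ((p ^ k : ℕ) : ℚ) = v' at *
      field_simp
      linear_combination (-bernoulli i * v' ^ 2 * v) * hc'

lemma voronoi_int (a N n : ℕ) (hN : 0 < N) (ha : a.Coprime N) :
    ∃ z : ℤ, (a : ℤ) ^ n * (∑ j ∈ Finset.range N, (j : ℤ) ^ n) - ∑ j ∈ Finset.range N, (j : ℤ) ^ n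
      = n * N * a ^ (n - 1) * (∑ j ∈ Finset.range N, (j : ℤ) ^ (n - 1) * ((j * a / N : ℕ) : ℤ))
        + N ^ 2 * z := by
  have hperm : ∑ j ∈ Finset.range N, (j : ℤ) ^ n
      = ∑ j ∈ Finset.range N, ((j * a % N : ℕ) : ℤ) ^ n := by
    symm
    have hmaps : ∀ j ∈ Finset.range N, j * a % N ∈ Finset.range N := fun j _ =>
      Finset.mem_range.2 (Nat.mod_lt _ hN)
    have hinj : Set.InjOn (fun j => j * a % N) (Finset.range N : Set ℕ) := by
      intro i hi j hj hij
      have hi := Finset.mem_range.1 hi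
      have hj := Finset.mem_range.1 hj
      have h1 : i * a ≡ j * a [MOD N] := hij
      have h2 : i ≡ j [MOD N] := Nat.ModEq.cancel_right_of_coprime ha.symm h1
      exact Nat.ModEq.eq_of_lt_of_lt h2 hi hj
    exact Finset.sum_nbij (fun j => j * a % N) hmaps hinj
      (Finset.surjOn_of_injOn_of_card_le _ hmaps hinj le_rfl) (fun _ _ => rfl)
  have hterm : ∀ j : ℕ, ∃ z : ℤ, ((j * a % N : ℕ) : ℤ) ^ n = (a : ℤ) ^ n * (j : ℤ) ^ n
      - n * N * a ^ (n - 1) * ((j : ℤ) ^ (n - 1) * ((j * a / N : ℕ) : ℤ)) + N ^ 2 * z := by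
    intro j
    obtain ⟨c, hc⟩ := Polynomial.powAddExpansion ((j : ℤ) * a) (-(N * ((j * a / N : ℕ) : ℤ))) n
    have h1 : ((j * a % N : ℕ) : ℤ) = (j : ℤ) * a + (-(N * ((j * a / N : ℕ) : ℤ))) := by
      have := Nat.mod_add_div (j * a) N
      zify at this ⊢
      linarith
    refine ⟨c * ((j * a / N : ℕ) : ℤ) ^ 2, ?_⟩
    rw [h1, hc, mul_pow, mul_pow]
    ring
  choose z hz using hterm
  refine ⟨-∑ j ∈ Finset.range N, z j, ?_⟩
  nth_rewrite 2 [hperm]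
  simp only [hz, Finset.sum_add_distrib, Finset.sum_sub_distrib, ← Finset.mul_sum]
  ring

/-- The sum in the Voronoi congruence. -/
def vor (a N n : ℕ) : ℤ := ∑ j ∈ Finset.range N, (j : ℤ) ^ (n - 1) * ((j * a / N : ℕ) : ℤ)

lemma voronoi {p : ℕ} (hp : p.Prime) (h5 : 5 ≤ p) (k n a : ℕ) (hk : 1 ≤ k) (hn : Even n)
    (ha : ¬ p ∣ a) :
    ∃ (u : ℤ) (d : ℕ), ¬ p ∣ d ∧ ((a : ℚ) ^ n - 1) * bernoulli n * d
      = n * a ^ (n - 1) * vor a (p ^ k) n * d + p ^ k * u := by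
  have hcop : a.Coprime (p ^ k) := Nat.Coprime.pow_right _ ((hp.coprime_iff_not_dvd.2 ha).symm)
  obtain ⟨z, hz⟩ := voronoi_int a (p ^ k) n (pow_pos hp.pos _) hcop
  obtain ⟨x, hx, hS⟩ := faulhaber_mod hp h5 k n hk hn
  have hy : PInt p (z + -((((a : ℤ) ^ n - 1 : ℤ) : ℚ) * x)) :=
    PInt.add hp (PInt.int hp z) (PInt.neg (PInt.mul hp (PInt.int hp _) hx))
  obtain ⟨u, d, hd, hu⟩ := hy
  refine ⟨u, d, hd, ?_⟩
  rw [← hu]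
  change _ = _ * _ * _ * vor a (p ^ k) n + _ at hz
  have hz' := congrArg (fun t : ℤ => (t : ℚ)) hz
  push_cast at hz' hS ⊢
  rw [hS] at hz'
  have hp0 : (p : ℚ) ^ k ≠ 0 := pow_ne_zero _ (by exact_mod_cast hp.ne_zero)
  apply mul_left_cancel₀ hp0
  linear_combination (d : ℚ) * hz'

lemma vor_congr {p : ℕ} (hp : p.Prime) (a N n l : ℕ) (hl : l ≡ n [MOD p - 1])
    (hl2 : 2 ≤ l) (hn2 : 2 ≤ n) : ((vor a N n : ℤ) : ZMod p) = ((vor a N l : ℤ) : ZMod p) := by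
  have := Fact.mk hp
  unfold vor
  push_cast
  refine Finset.sum_congr rfl fun j _ => ?_
  congr 1
  by_cases hj : (j : ZMod p) = 0
  · rw [hj, zero_pow (by omega), zero_pow (by omega)]
  · have h1 : l - 1 ≡ n - 1 [MOD p - 1] := by
      apply Nat.ModEq.add_right_cancel' 1
      rwa [Nat.sub_add_cancel (by omega), Nat.sub_add_cancel (by omega)]
    have h2 := ZMod.pow_card_sub_one_eq_one hj
    exact (pow_eq_pow_of_modEq h1 h2).symm


/-- Extended Adams theorem, regular case: if `p^r ∥ n` (`r ≥ 1`), `p-1 ∤ n`,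
and `p` does not divide the numerator of `B_l/l` for the `l ≡ n (mod p-1)` with
`0 < l < p-1`, then `p^r` exactly divides the numerator of `B_n`. -/
theorem stmt_18 (n p r l : ℕ) (hn : 0 < n) (hne : Even n) (hp : p.Prime)
    (hr : 1 ≤ r) (hdvd : p^r ∣ n) (hndvd : ¬ p^(r + 1) ∣ n)
    (hpn : ¬ (p - 1) ∣ n)
    (hl : l ≡ n [MOD p - 1]) (hl0 : 0 < l) (hlp : l < p - 1)
    (hreg : ¬ (p : ℤ) ∣ (bernoulli l / l).num) :
    ((p : ℤ)^r) ∣ (bernoulli n).num ∧ ¬ ((p : ℤ)^(r + 1)) ∣ (bernoulli n).num := by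
  have := Fact.mk hp
  have hp2 := hp.two_le
  have hpne2 : p ≠ 2 := by rintro rfl; exact hpn (by simp)
  have hpne3 : p ≠ 3 := by rintro rfl; exact hpn (by simpa using hne.two_dvd)
  have hpodd := hp.eq_two_or_odd'.resolve_left hpne2
  have h5 : 5 ≤ p := by
    obtain ⟨t, rfl⟩ := hpodd
    omega
  have hle : Even l := by
    have h2 : 2 ∣ p - 1 := by obtain ⟨t, rfl⟩ := hpodd; exact ⟨t, by omega⟩
    have := hl.of_dvd h2
    rw [Nat.even_iff] at hne ⊢
    exact Eq.trans this hne
  have hl2 : 2 ≤ l := by obtain ⟨t, rfl⟩ := hle; omega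
  have hn2 : 2 ≤ n := by obtain ⟨t, rfl⟩ := hne; omega
  -- a primitive root
  obtain ⟨a, ha, hord⟩ : ∃ a : ℕ, ¬ p ∣ a ∧ orderOf (a : ZMod p) = p - 1 := by
    obtain ⟨g, hg⟩ := IsCyclic.exists_generator (α := (ZMod p)ˣ)
    refine ⟨(g : ZMod p).val, ?_, ?_⟩
    · rw [← ZMod.natCast_eq_zero_iff, ZMod.natCast_zmod_val]
      exact g.ne_zero
    · rw [ZMod.natCast_zmod_val, orderOf_units, orderOf_eq_card_of_forall_mem_zpowers hg,
        Nat.card_eq_fintype_card, ZMod.card_units]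
  have hpow : ∀ t : ℕ, ¬ (p - 1) ∣ t → ¬ (p : ℤ) ∣ (a : ℤ) ^ t - 1 := by
    intro t ht h
    rw [← ZMod.intCast_zmod_eq_zero_iff_dvd _ p] at h
    push_cast at h
    exact ht (hord ▸ orderOf_dvd_of_pow_eq_one (sub_eq_zero.1 h))
  have hpZ : Prime (p : ℤ) := Nat.prime_iff_prime_int.1 hp
  have hal := hpow l (Nat.not_dvd_of_pos_of_lt hl0 hlp)
  have han := hpow n hpn
  have hT : ¬ (p : ℤ) ∣ vor a (p ^ (r + 1)) l := by
    rintro ⟨c, hc⟩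
    obtain ⟨u, d, hd, h⟩ := voronoi hp h5 (r + 1) l a (by omega) hle ha
    apply hreg
    have hl0' : (l : ℚ) ≠ 0 := by exact_mod_cast hl0.ne'
    set q := bernoulli l / l with hq
    have hb : bernoulli l = q * l := by rw [hq]; field_simp
    have hqd : (q.den : ℚ) ≠ 0 := by exact_mod_cast q.den_ne_zero
    have hqq : q * q.den = q.num := Rat.mul_den_eq_num q
    have key : ((a : ℤ) ^ l - 1) * q.num * l * d
        = p * (q.den * (l * a ^ (l - 1) * c * d + p ^ r * u)) := by
      have hc' := congrArg (fun t : ℤ => (t : ℚ)) hc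
      push_cast at hc'
      rw [hb, hc'] at h
      have : (((a : ℚ)) ^ l - 1) * q.num * l * d
        = p * (q.den * (l * a ^ (l - 1) * c * d + p ^ r * u)) := by
        rw [← hqq]
        linear_combination (q.den : ℚ) * h
      exact_mod_cast this
    have hdv : (p : ℤ) ∣ ((a : ℤ) ^ l - 1) * q.num * l * d := ⟨_, key⟩
    rcases hpZ.dvd_mul.1 hdv with hdv | hdv
    · rcases hpZ.dvd_mul.1 hdv with hdv | hdv
      · exact (hpZ.dvd_mul.1 hdv).resolve_left hal
      · exact absurd (Int.natCast_dvd_natCast.1 hdv) (Nat.not_dvd_of_pos_of_lt hl0 (by omega))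
    · exact absurd (Int.natCast_dvd_natCast.1 hdv) hd
  have hTn : ¬ (p : ℤ) ∣ vor a (p ^ (r + 1)) n := by
    rw [← ZMod.intCast_zmod_eq_zero_iff_dvd _ p] at hT ⊢
    rwa [vor_congr hp a _ n l hl hl2 hn2]
  obtain ⟨m, hm⟩ := hdvd
  have hpm : ¬ p ∣ m := by
    rintro ⟨c, rfl⟩
    exact hndvd ⟨c, by rw [hm]; ring⟩
  obtain ⟨u, d, hd, h⟩ := voronoi hp h5 (r + 1) n a (by omega) hne ha
  have hqq := Rat.mul_den_eq_num (bernoulli n)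
  have hcop := (bernoulli n).reduced
  set q := bernoulli n with hq
  have key : ((a : ℤ) ^ n - 1) * d * q.num
      = p ^ r * (q.den * (m * a ^ (n - 1) * vor a (p ^ (r + 1)) n * d + p * u)) := by
    have hm' : (n : ℚ) = p ^ r * m := by rw [hm]; push_cast; ring
    have : ((a : ℚ) ^ n - 1) * d * q.num
      = p ^ r * (q.den * (m * a ^ (n - 1) * vor a (p ^ (r + 1)) n * d + p * u)) := by
      rw [← hqq]
      rw [hm'] at h
      linear_combination (q.den : ℚ) * h
    exact_mod_cast this
  have hunit : ¬ (p : ℤ) ∣ ((a : ℤ) ^ n - 1) * d := by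
    intro hdv
    rcases hpZ.dvd_mul.1 hdv with hdv | hdv
    · exact han hdv
    · exact hd (Int.natCast_dvd_natCast.1 hdv)
  have hdvdr : (p : ℤ) ^ r ∣ q.num := hpZ.pow_dvd_of_dvd_mul_left r hunit ⟨_, key⟩
  refine ⟨hdvdr, ?_⟩
  rintro ⟨c, hc⟩
  have hpnum : (p : ℤ) ∣ q.num := ⟨p ^ r * c, by rw [hc]; ring⟩
  have hpden : ¬ (p : ℤ) ∣ q.den := by
    intro hdv
    have h1 : p ∣ q.num.natAbs := Int.natCast_dvd.1 hpnum
    have h2 : p ∣ q.den := Int.natCast_dvd_natCast.1 hdv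
    exact hp.one_lt.ne' (Nat.dvd_one.1 (hcop ▸ Nat.dvd_gcd h1 h2))
  have hpr : (p : ℤ) ^ r ≠ 0 := pow_ne_zero _ hpZ.ne_zero
  have h3 : (p : ℤ) * (((a : ℤ) ^ n - 1) * d * c)
      = q.den * (m * a ^ (n - 1) * vor a (p ^ (r + 1)) n * d + p * u) := by
    apply mul_left_cancel₀ hpr
    rw [← key, hc]
    ring
  have h4 := (hpZ.dvd_mul.1 (Dvd.intro _ h3)).resolve_left hpden
  have h5 := (Int.dvd_add_left (Dvd.intro _ rfl)).1 h4
  rcases hpZ.dvd_mul.1 h5 with h5 | h5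
  · rcases hpZ.dvd_mul.1 h5 with h5 | h5
    · rcases hpZ.dvd_mul.1 h5 with h5 | h5
      · exact hpm (Int.natCast_dvd_natCast.1 h5)
      · exact ha (Int.natCast_dvd_natCast.1 (hpZ.dvd_of_dvd_pow h5))
    · exact hTn h5
  · exact hd (Int.natCast_dvd_natCast.1 h5)
end
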